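/- arXiv:0810.1799 — 14 statements merged into one kernel-verified Lean document; each statement's English description precedes it below -/
import Mathlib

section
/- A matrix φ ∈ SL₂(ℤ) has finite order if and only if there exists P ∈ GL₂(ℤ) such that P·φ·P⁻¹ is one of the five matrices [[1,0],[0,1]], [[-1,0],[0,-1]], [[-1,-1],[1,0]], [[0,-1],[1,0]], [[0,-1],[1,1]]; moreover these five matrices have multiplicative orders 1, 2, 3, 4 and 6 respectively. -/
/-- An integral binary quadratic form of discriminant `-3` or `-4` represents `1` or `-1`. -/
theorem exists_quadratic_form_isUnit (A B C : ℤ)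
    (h : B ^ 2 - 4 * A * C = -3 ∨ B ^ 2 - 4 * A * C = -4) :
    ∃ x y : ℤ, IsUnit (A * x ^ 2 + B * x * y + C * y ^ 2) := by
  induction hn : A.natAbs using Nat.strong_induction_on generalizing A B C with
  | _ n ih =>
    have hA : A ≠ 0 := by
      rintro rfl
      rcases h with h | h <;> nlinarith [sq_nonneg B]
    by_cases hA1 : IsUnit A
    · exact ⟨1, 0, by simpa using hA1⟩
    have hA2 : 2 ≤ |A| := by
      rw [Int.isUnit_iff] at hA1
      grind
    obtain ⟨k, hk⟩ : ∃ k : ℤ, |B + 2 * A * k| ≤ |A| := by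
      have hpos : 0 < 2 * A.natAbs := by omega
      have h1 := Int.le_bmod (x := B) hpos
      have h2 := Int.bmod_lt (x := B) hpos
      obtain ⟨q, hq⟩ : 2 * A ∣ Int.bmod B (2 * A.natAbs) - B := by
        have h3 : ((2 * A.natAbs : ℕ) : ℤ) ∣ Int.bmod B (2 * A.natAbs) - B :=
          Int.dvd_bmod_sub_self
        rw [← Int.natAbs_dvd, Int.natAbs_mul]
        exact h3
      refine ⟨q, ?_⟩
      rw [← hq, abs_le]
      push_cast at h1 h2
      constructor <;> grind
    have hdisc : (B + 2 * A * k) ^ 2 - 4 * A * (A * k ^ 2 + B * k + C) = B ^ 2 - 4 * A * C := by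
      ring
    have hlt : |A * k ^ 2 + B * k + C| < |A| := by
      have hsq : (B + 2 * A * k) ^ 2 ≤ |A| ^ 2 := by
        rw [← sq_abs (B + 2 * A * k)]
        gcongr
      have hmul : 4 * (|A| * |A * k ^ 2 + B * k + C|) ≤ |A| ^ 2 + 4 := by
        rw [← abs_mul]
        rcases abs_cases (A * (A * k ^ 2 + B * k + C)) with ⟨e, -⟩ | ⟨e, -⟩ <;> rw [e] <;>
          rcases h with h | h <;> nlinarith [sq_nonneg (B + 2 * A * k)]
      nlinarith
    obtain ⟨x, y, hxy⟩ := ih _ (by rw [← hn]; zify; exact hlt) (A * k ^ 2 + B * k + C) (-(B + 2 * A * k)) A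
      (by rcases h with h | h <;> [left; right] <;> linarith) rfl
    refine ⟨k * x - y, x, ?_⟩
    convert hxy using 1
    ring

/-- If `M` intertwines `φ` and `T` and has unit determinant, then `φ` and `T` are conjugate. -/
theorem exists_conj_eq_of_mul_eq_mul {φ M T : Matrix (Fin 2) (Fin 2) ℤ} (hM : IsUnit M.det)
    (h : φ * M = M * T) :
    ∃ P : GL (Fin 2) ℤ,
      (P : Matrix (Fin 2) (Fin 2) ℤ) * φ * ((P⁻¹ : GL (Fin 2) ℤ) : Matrix (Fin 2) (Fin 2) ℤ)
        = T := by
  obtain ⟨G, rfl⟩ := (Matrix.isUnit_iff_isUnit_det M).mpr hM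
  refine ⟨G⁻¹, ?_⟩
  rw [inv_inv, mul_assoc, h, Units.inv_mul_cancel_left]

/-- Powers of a unimodular `2 × 2` matrix whose trace has absolute value at least `2` are affine
in the matrix, with a nonzero leading coefficient. -/
theorem exists_pow_succ_eq_smul_sub {φ : Matrix (Fin 2) (Fin 2) ℤ} (hφ : φ.det = 1)
    (ht : 2 ≤ |φ.trace|) (n : ℕ) :
    ∃ u v : ℤ, |v| < |u| ∧ φ ^ (n + 1) = u • φ - v • (1 : Matrix (Fin 2) (Fin 2) ℤ) := by
  induction n with
  | zero => exact ⟨1, 0, by simp, by simp⟩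
  | succ n ih =>
    obtain ⟨u, v, huv, h⟩ := ih
    have hsq : φ * φ = φ.trace • φ - 1 := by
      rw [Matrix.det_fin_two] at hφ
      ext i j
      fin_cases i <;> fin_cases j <;>
        simp [Matrix.mul_apply, Fin.sum_univ_two, Matrix.trace_fin_two, -zsmul_eq_mul] <;>
        linarith
    refine ⟨φ.trace * u - v, u, ?_, ?_⟩
    · have h1 : |φ.trace * u| - |v| ≤ |φ.trace * u - v| := abs_sub_abs_le_abs_sub _ _
      rw [abs_mul] at h1
      nlinarith [abs_nonneg u]
    · rw [pow_succ, h, sub_mul, smul_mul_assoc, hsq, smul_mul_assoc, one_mul, smul_sub, sub_smul,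
        smul_smul, mul_comm u]
      abel

/-- A unimodular integral `2 × 2` matrix of finite order whose trace has absolute value at least
`2` is `1` or `-1`. -/
theorem eq_one_or_eq_neg_one_of_isOfFinOrder {φ : Matrix (Fin 2) (Fin 2) ℤ} (hφ : φ.det = 1)
    (ht : 2 ≤ |φ.trace|) (h : IsOfFinOrder φ) :
    φ = !![1, 0; 0, 1] ∨ φ = !![-1, 0; 0, -1] := by
  obtain ⟨n, hn, hpow⟩ := isOfFinOrder_iff_pow_eq_one.mp h
  obtain ⟨m, rfl⟩ := Nat.exists_eq_add_of_lt hn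
  rw [zero_add] at hpow
  obtain ⟨u, v, huv, huv'⟩ := exists_pow_succ_eq_smul_sub hφ ht m
  rw [hpow] at huv'
  have hu : u ≠ 0 := by
    rintro rfl
    simp only [abs_zero] at huv
    exact absurd (abs_nonneg v) (not_le.mpr huv)
  have h00 := congrFun (congrFun huv' 0) 0
  have h01 := congrFun (congrFun huv' 0) 1
  have h10 := congrFun (congrFun huv' 1) 0
  have h11 := congrFun (congrFun huv' 1) 1
  simp only [Matrix.sub_apply, Matrix.smul_apply, Matrix.one_apply, smul_eq_mul] at h00 h01 h10 h11
  simp [hu] at h00 h01 h10 h11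
  have hd : φ 0 0 = φ 1 1 := mul_left_cancel₀ hu (by linarith)
  rw [Matrix.det_fin_two, h01, hd, zero_mul, sub_zero] at hφ
  rw [Matrix.eta_fin_two φ, h01, h10, hd]
  rcases Int.eq_one_or_neg_one_of_mul_eq_one hφ with e | e <;> simp [e]

/-- A unimodular integral `2 × 2` matrix of trace `-1`, `0` or `1` admits a vector `(x, y)` which
together with its image spans `ℤ²`. -/
theorem exists_isUnit_det_vector_image {φ : Matrix (Fin 2) (Fin 2) ℤ} (hφ : φ.det = 1)
    (ht : |φ.trace| < 2) :
    ∃ x y : ℤ, IsUnit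
      (!![x, φ 0 0 * x + φ 0 1 * y; y, φ 1 0 * x + φ 1 1 * y] : Matrix (Fin 2) (Fin 2) ℤ).det := by
  have hdisc : (φ 1 1 - φ 0 0) ^ 2 - 4 * φ 1 0 * (-φ 0 1) = φ.trace ^ 2 - 4 := by
    rw [Matrix.det_fin_two] at hφ
    rw [Matrix.trace_fin_two]
    linear_combination (-4) * hφ
  obtain ⟨x, y, hxy⟩ := exists_quadratic_form_isUnit (φ 1 0) (φ 1 1 - φ 0 0) (-φ 0 1) (by
    rw [hdisc]
    rw [abs_lt] at ht
    obtain ⟨h1, h2⟩ := ht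
    generalize φ.trace = t at *
    interval_cases t <;> simp)
  refine ⟨x, y, ?_⟩
  convert hxy using 1
  rw [Matrix.det_fin_two_of]
  ring

/-- The companion form of a unimodular integral `2 × 2` matrix of trace `-1`, `0` or `1`. -/
theorem exists_conj_eq_companion {φ : Matrix (Fin 2) (Fin 2) ℤ} (hφ : φ.det = 1)
    (ht : |φ.trace| < 2) :
    ∃ P : GL (Fin 2) ℤ,
      (P : Matrix (Fin 2) (Fin 2) ℤ) * φ * ((P⁻¹ : GL (Fin 2) ℤ) : Matrix (Fin 2) (Fin 2) ℤ)
        = !![0, -1; 1, φ.trace] := by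
  obtain ⟨x, y, hxy⟩ := exists_isUnit_det_vector_image hφ ht
  refine exists_conj_eq_of_mul_eq_mul hxy ?_
  rw [Matrix.det_fin_two] at hφ
  ext i j
  fin_cases i <;> fin_cases j <;>
    simp [Matrix.mul_apply, Fin.sum_univ_two, Matrix.trace_fin_two]
  · linear_combination (-x) * hφ
  · linear_combination (-y) * hφ

/-- A unimodular integral `2 × 2` matrix of trace `-1` is conjugate to `!![-1, -1; 1, 0]`. -/
theorem exists_conj_eq_of_trace_eq_neg_one {φ : Matrix (Fin 2) (Fin 2) ℤ} (hφ : φ.det = 1)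
    (ht : φ.trace = -1) :
    ∃ P : GL (Fin 2) ℤ,
      (P : Matrix (Fin 2) (Fin 2) ℤ) * φ * ((P⁻¹ : GL (Fin 2) ℤ) : Matrix (Fin 2) (Fin 2) ℤ)
        = !![-1, -1; 1, 0] := by
  obtain ⟨x, y, hxy⟩ := exists_isUnit_det_vector_image hφ (by simp [ht])
  refine exists_conj_eq_of_mul_eq_mul
    (M := !![x, φ 0 0 * x + φ 0 1 * y + x; y, φ 1 0 * x + φ 1 1 * y + y]) ?_ ?_
  · convert hxy using 1
    simp only [Matrix.det_fin_two_of]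
    ring
  rw [Matrix.det_fin_two] at hφ
  rw [Matrix.trace_fin_two] at ht
  ext i j
  fin_cases i <;> fin_cases j <;> simp [Matrix.mul_apply, Fin.sum_univ_two]
  · linear_combination (-x) * hφ + (φ 0 0 * x + φ 0 1 * y) * ht
  · linear_combination (-y) * hφ + (φ 1 0 * x + φ 1 1 * y) * ht

/-- An element with a conjugate of positive order has finite order. -/
theorem isOfFinOrder_of_conj_eq {M : Type*} [Monoid M] {x y : M} {n : ℕ} (hn : 0 < n)
    (hy : orderOf y = n) (P : Mˣ) (h : (P : M) * x * ((P⁻¹ : Mˣ) : M) = y) : IsOfFinOrder x := by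
  refine isOfFinOrder_iff_pow_eq_one.mpr ⟨n, hn, ?_⟩
  have hp : y ^ n = 1 := hy ▸ pow_orderOf_eq_one y
  rw [← h, Units.conj_pow, Units.mul_inv_eq_one] at hp
  exact P.mul_right_inj.mp (hp.trans (mul_one _).symm)

/-- Proposition 1.3(1): a matrix `φ ∈ SL₂(ℤ)` has finite order iff it is conjugate in
`GL₂(ℤ)` to one of five specific matrices, whose orders are `1, 2, 3, 4, 6`. -/
theorem sl2_finite_order_iff_conjugate
    (φ : Matrix (Fin 2) (Fin 2) ℤ) (hφ : φ.det = 1) :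
    (IsOfFinOrder φ ↔
      ∃ P : GL (Fin 2) ℤ,
        (P : Matrix (Fin 2) (Fin 2) ℤ) * φ * ((P⁻¹ : GL (Fin 2) ℤ) : Matrix (Fin 2) (Fin 2) ℤ)
            = !![1, 0; 0, 1] ∨
        (P : Matrix (Fin 2) (Fin 2) ℤ) * φ * ((P⁻¹ : GL (Fin 2) ℤ) : Matrix (Fin 2) (Fin 2) ℤ)
            = !![-1, 0; 0, -1] ∨
        (P : Matrix (Fin 2) (Fin 2) ℤ) * φ * ((P⁻¹ : GL (Fin 2) ℤ) : Matrix (Fin 2) (Fin 2) ℤ)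
            = !![-1, -1; 1, 0] ∨
        (P : Matrix (Fin 2) (Fin 2) ℤ) * φ * ((P⁻¹ : GL (Fin 2) ℤ) : Matrix (Fin 2) (Fin 2) ℤ)
            = !![0, -1; 1, 0] ∨
        (P : Matrix (Fin 2) (Fin 2) ℤ) * φ * ((P⁻¹ : GL (Fin 2) ℤ) : Matrix (Fin 2) (Fin 2) ℤ)
            = !![0, -1; 1, 1]) ∧
    orderOf (!![1, 0; 0, 1] : Matrix (Fin 2) (Fin 2) ℤ) = 1 ∧
    orderOf (!![-1, 0; 0, -1] : Matrix (Fin 2) (Fin 2) ℤ) = 2 ∧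
    orderOf (!![-1, -1; 1, 0] : Matrix (Fin 2) (Fin 2) ℤ) = 3 ∧
    orderOf (!![0, -1; 1, 0] : Matrix (Fin 2) (Fin 2) ℤ) = 4 ∧
    orderOf (!![0, -1; 1, 1] : Matrix (Fin 2) (Fin 2) ℤ) = 6 := by
  have h1 : orderOf (!![1, 0; 0, 1] : Matrix (Fin 2) (Fin 2) ℤ) = 1 := by
    rw [← Matrix.one_fin_two, orderOf_one]
  have h2 : orderOf (!![-1, 0; 0, -1] : Matrix (Fin 2) (Fin 2) ℤ) = 2 :=
    (orderOf_eq_iff (by norm_num)).mpr (by decide)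
  have h3 : orderOf (!![-1, -1; 1, 0] : Matrix (Fin 2) (Fin 2) ℤ) = 3 :=
    (orderOf_eq_iff (by norm_num)).mpr (by decide)
  have h4 : orderOf (!![0, -1; 1, 0] : Matrix (Fin 2) (Fin 2) ℤ) = 4 :=
    (orderOf_eq_iff (by norm_num)).mpr (by decide)
  have h6 : orderOf (!![0, -1; 1, 1] : Matrix (Fin 2) (Fin 2) ℤ) = 6 :=
    (orderOf_eq_iff (by norm_num)).mpr (by decide)
  refine ⟨⟨fun h => ?_, ?_⟩, h1, h2, h3, h4, h6⟩
  · rcases le_or_gt 2 |φ.trace| with ht | ht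
    · refine ⟨1, ?_⟩
      rcases eq_one_or_eq_neg_one_of_isOfFinOrder hφ ht h with e | e <;> simp [e]
    · obtain ⟨P, hP⟩ := exists_conj_eq_companion hφ ht
      have hcases : φ.trace = -1 ∨ φ.trace = 0 ∨ φ.trace = 1 := by
        rw [abs_lt] at ht
        omega
      rcases hcases with e | e | e
      · obtain ⟨P, hP⟩ := exists_conj_eq_of_trace_eq_neg_one hφ e
        exact ⟨P, .inr (.inr (.inl hP))⟩
      · exact ⟨P, .inr (.inr (.inr (.inl (e ▸ hP))))⟩
      · exact ⟨P, .inr (.inr (.inr (.inr (e ▸ hP))))⟩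
  · rintro ⟨P, h | h | h | h | h⟩
    · exact isOfFinOrder_of_conj_eq (by norm_num) h1 P h
    · exact isOfFinOrder_of_conj_eq (by norm_num) h2 P h
    · exact isOfFinOrder_of_conj_eq (by norm_num) h3 P h
    · exact isOfFinOrder_of_conj_eq (by norm_num) h4 P h
    · exact isOfFinOrder_of_conj_eq (by norm_num) h6 P h
end

section
/- A matrix φ ∈ SL₂(ℤ) satisfies |tr φ| = 2 and φ ≠ ±I if and only if there exist P ∈ GL₂(ℤ) and a nonzero integer n such that P·φ·P⁻¹ equals [[1,n],[0,1]] or −[[1,n],[0,1]]. -/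
/-- An integer `2 × 2` matrix of determinant `1` and trace `2` is conjugate to an upper
unitriangular one. -/
theorem exists_conj_eq_upper_unipotent (φ : Matrix (Fin 2) (Fin 2) ℤ) (hdet : φ.det = 1)
    (htr : φ.trace = 2) :
    ∃ (P : GL (Fin 2) ℤ) (n : ℤ),
      (P : Matrix (Fin 2) (Fin 2) ℤ) * φ * ((P⁻¹ : GL (Fin 2) ℤ) : Matrix (Fin 2) (Fin 2) ℤ)
        = !![1, n; 0, 1] := by
  obtain ⟨g, p, q, u, v, hx, hc, huv, hb⟩ : ∃ g p q u v : ℤ, φ 0 0 - 1 = g * p ∧ φ 1 0 = g * q ∧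
      u * p + v * q = 1 ∧ φ 0 1 * q = -(g * p ^ 2) := by
    rw [Matrix.det_fin_two] at hdet
    rw [Matrix.trace_fin_two] at htr
    have hd : φ 1 1 = 2 - φ 0 0 := by linarith
    rw [hd] at hdet
    by_cases hg : Int.gcd (φ 0 0 - 1) (φ 1 0) = 0
    · obtain ⟨h1, h2⟩ := Int.gcd_eq_zero_iff.mp hg
      exact ⟨0, 1, 0, 1, 0, by simpa using h1, by simpa using h2, by simp, by simp⟩
    · obtain ⟨p, q, hpq, hp, hq⟩ := Int.exists_gcd_one (Nat.pos_of_ne_zero hg)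
      obtain ⟨u, v, huv⟩ := Int.isCoprime_iff_gcd_eq_one.mpr hpq
      have hg' : (Int.gcd (φ 0 0 - 1) (φ 1 0) : ℤ) ≠ 0 := by exact_mod_cast hg
      generalize (Int.gcd (φ 0 0 - 1) (φ 1 0) : ℤ) = g at hp hq hg'
      refine ⟨g, p, q, u, v, by linarith, by linarith, huv, mul_left_cancel₀ hg' ?_⟩
      have h0 : φ 0 0 = p * g + 1 := by linarith
      rw [h0, hq] at hdet
      linear_combination -hdet
  have hd : φ 1 1 = 1 - g * p := by
    rw [Matrix.trace_fin_two] at htr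
    linarith
  have ha : φ 0 0 = 1 + g * p := by linarith
  let P : GL (Fin 2) ℤ := Matrix.GeneralLinearGroup.mk'' !![u, v; -q, p] (by
    rw [Matrix.det_fin_two_of]
    exact ⟨1, by push_cast; linarith⟩)
  refine ⟨P, φ 0 1 * u ^ 2 - 2 * u * v * g * p - g * q * v ^ 2, ?_⟩
  rw [Units.mul_inv_eq_iff_eq_mul]
  change !![u, v; -q, p] * φ = _ * !![u, v; -q, p]
  ext i j
  fin_cases i <;> fin_cases j <;> simp [Matrix.mul_apply, ha, hc, hd]
  · linear_combination u ^ 2 * hb - g * (u * p + v * q) * huv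
  · linear_combination u * v * hb + (v * g * p - u * φ 0 1) * huv
  · ring
  · linear_combination -hb

/-- If a unit commutes with `z`, then conjugating `x` by it gives `z` iff `x = z`. -/
theorem Units.conj_eq_iff_of_commute {M : Type*} [Monoid M] (P : Mˣ) {x z : M}
    (hz : Commute (P : M) z) : (P : M) * x * ((P⁻¹ : Mˣ) : M) = z ↔ x = z := by
  rw [Units.mul_inv_eq_iff_eq_mul, ← hz.eq, Units.mul_right_inj]

/-- Proposition 1.3(2): a matrix `φ ∈ SL₂(ℤ)` has `|tr φ| = 2` and `φ ≠ ±I` iff it is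
conjugate in `GL₂(ℤ)` to `±[[1,n],[0,1]]` for some nonzero integer `n`. -/
theorem sl2_trace_two_iff_conjugate
    (φ : Matrix (Fin 2) (Fin 2) ℤ) (hφ : φ.det = 1) :
    (|φ.trace| = 2 ∧ φ ≠ 1 ∧ φ ≠ -1) ↔
      ∃ (P : GL (Fin 2) ℤ) (n : ℤ), n ≠ 0 ∧
        ((P : Matrix (Fin 2) (Fin 2) ℤ) * φ * ((P⁻¹ : GL (Fin 2) ℤ) : Matrix (Fin 2) (Fin 2) ℤ)
            = !![1, n; 0, 1] ∨
         (P : Matrix (Fin 2) (Fin 2) ℤ) * φ * ((P⁻¹ : GL (Fin 2) ℤ) : Matrix (Fin 2) (Fin 2) ℤ)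
            = -!![1, n; 0, 1]) := by
  constructor
  · rintro ⟨htr, h1, h2⟩
    rcases (abs_eq (by norm_num)).mp htr with h | h
    · obtain ⟨P, n, hP⟩ := exists_conj_eq_upper_unipotent φ hφ h
      refine ⟨P, n, ?_, Or.inl hP⟩
      rintro rfl
      rw [← Matrix.one_fin_two, P.conj_eq_iff_of_commute (Commute.one_right _)] at hP
      exact h1 hP
    · obtain ⟨P, n, hP⟩ := exists_conj_eq_upper_unipotent (-φ)
        (by simp [Matrix.det_neg, hφ]) (by simp [h])
      refine ⟨P, n, ?_, Or.inr ?_⟩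
      · rintro rfl
        rw [← Matrix.one_fin_two, P.conj_eq_iff_of_commute (Commute.one_right _)] at hP
        exact h2 (neg_eq_iff_eq_neg.mp hP)
      · rw [← hP, mul_neg, neg_mul, neg_neg]
  · rintro ⟨P, n, hn, hP⟩
    have htr := Matrix.trace_units_conj P φ
    refine ⟨?_, ?_, ?_⟩
    · rw [← htr]
      rcases hP with hP | hP <;> rw [hP] <;> simp [Matrix.trace_fin_two]
    · rintro rfl
      rw [(P.conj_eq_iff_of_commute (Commute.one_right _)).mpr rfl] at hP
      rcases hP with hP | hP <;> exact hn (by simpa using (congrFun₂ hP 0 1).symm)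
    · rintro rfl
      rw [(P.conj_eq_iff_of_commute (Commute.neg_one_right _)).mpr rfl] at hP
      rcases hP with hP | hP <;> exact hn (by simpa using (congrFun₂ hP 0 1).symm)
end

section
/- Let φ be a 2×2 integer matrix with det φ = 1 and |tr φ| > 2. If A is a 2×2 integer matrix with det A ≠ 0, ε ∈ {1,−1}, and k is a positive integer such that A·φ = (φ^ε)^k·A, then k = 1. -/
namespace Matrix

theorem trace_pow_add_two_of_det_eq_one {R : Type*} [CommRing R]
    (M : Matrix (Fin 2) (Fin 2) R) (hM : M.det = 1) (n : ℕ) :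
    (M ^ (n + 2)).trace = M.trace * (M ^ (n + 1)).trace - (M ^ n).trace := by
  have h : M ^ 2 = M.trace • M - 1 := by
    rw [det_fin_two] at hM
    ext i j
    fin_cases i <;> fin_cases j <;> simp [pow_two, mul_apply, trace_fin_two] <;>
      first | linear_combination -hM | ring
  rw [pow_add, h, mul_sub, mul_smul_comm, ← pow_succ, mul_one, trace_sub, trace_smul, smul_eq_mul]

theorem strictMono_abs_trace_pow (M : Matrix (Fin 2) (Fin 2) ℤ) (hM : M.det = 1)
    (htr : 2 < |M.trace|) : StrictMono fun n : ℕ => |(M ^ n).trace| := by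
  refine strictMono_nat_of_lt_succ fun n => ?_
  induction n with
  | zero => simpa [trace_one] using htr
  | succ n ih =>
    rw [trace_pow_add_two_of_det_eq_one M hM n]
    have h := abs_sub_abs_le_abs_sub (M.trace * (M ^ (n + 1)).trace) (M ^ n).trace
    rw [abs_mul] at h
    nlinarith [abs_nonneg (M ^ (n + 1)).trace]

theorem trace_eq_of_mul_eq_mul {n R : Type*} [Fintype n] [DecidableEq n] [CommRing R] [IsDomain R]
    {A M N : Matrix n n R} (hA : A.det ≠ 0) (h : A * M = N * A) : M.trace = N.trace := by
  refine mul_left_cancel₀ hA ?_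
  calc A.det * M.trace = (A.adjugate * (A * M)).trace := by
        rw [← mul_assoc, adjugate_mul, smul_mul_assoc, one_mul, trace_smul, smul_eq_mul]
    _ = A.det * N.trace := by
        rw [h, trace_mul_comm, mul_assoc, mul_adjugate, mul_smul_comm, mul_one, trace_smul,
          smul_eq_mul]

end Matrix

/-- Key step in case 2.I of the proof of Theorem 1.4: if `φ ∈ SL₂(ℤ)` is Anosov
(`|tr φ| > 2`), `A` is a nondegenerate integer matrix, `ε = ±1` and `k > 0` satisfy
`A·φ = (φ^ε)^k·A`, then `k = 1`. -/
theorem anosov_intertwiner_k_eq_one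
    (φ A : Matrix (Fin 2) (Fin 2) ℤ) (hφ : φ.det = 1) (htr : 2 < |φ.trace|)
    (hA : A.det ≠ 0) (ε : ℤ) (hε : ε = 1 ∨ ε = -1) (k : ℕ) (hk : 0 < k)
    (heq : A * φ = (φ ^ ε) ^ k * A) :
    k = 1 := by
  have hdet : (φ ^ ε).det = 1 := by
    rcases hε with rfl | rfl
    · simpa using hφ
    · simp [Matrix.zpow_neg_one, Matrix.det_nonsing_inv, hφ]
  have htrace : (φ ^ ε).trace = φ.trace := by
    rcases hε with rfl | rfl
    · simp
    · simp [Matrix.zpow_neg_one, Matrix.inv_def, hφ, Matrix.adjugate_fin_two,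
        Matrix.trace_fin_two, add_comm]
  refine (Matrix.strictMono_abs_trace_pow (φ ^ ε) hdet (htrace ▸ htr)).injective ?_
  simp only [pow_one, htrace, Matrix.trace_eq_of_mul_eq_mul hA heq]
end

section
/- Let a,b,c,d be integers with a·d − b·c = 1, b ≠ 0 and c ≠ 0, and let φ = [[a,b],[c,d]]. A 2×2 integer matrix A = [[p,q],[r,s]] satisfies A·φ = φ⁻¹·A if and only if s = −p and c·q = (d−a)·p − b·r. In that case c·det A = −(c·p² + (d−a)·p·r − b·r²). -/
/-- The inverse of a `2 × 2` matrix of determinant one is its adjugate. -/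
theorem inv_fin_two_of_det_eq_one {R : Type*} [CommRing R] {a b c d : R}
    (h : a * d - b * c = 1) : (!![a, b; c, d])⁻¹ = !![d, -b; -c, a] := by
  rw [Matrix.inv_def, Matrix.det_fin_two_of, h, Ring.inverse_one, one_smul,
    Matrix.adjugate_fin_two_of]

/-- Case 2.I (`ε = -1`) in Section 3: solution of the equation `A·φ = φ⁻¹·A` for
`φ = [[a,b],[c,d]] ∈ SL₂(ℤ)` with `b ≠ 0`, `c ≠ 0`, and the resulting value of `c·det A`. -/
theorem anti_commuting_matrix_solution (a b c d p q r s : ℤ)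
    (h1 : a * d - b * c = 1) (hb : b ≠ 0) (hc : c ≠ 0) :
    (!![p, q; r, s] * !![a, b; c, d] = (!![a, b; c, d])⁻¹ * !![p, q; r, s] ↔
      s = -p ∧ c * q = (d - a) * p - b * r) ∧
    (!![p, q; r, s] * !![a, b; c, d] = (!![a, b; c, d])⁻¹ * !![p, q; r, s] →
      c * (!![p, q; r, s] : Matrix (Fin 2) (Fin 2) ℤ).det
        = -(c * p ^ 2 + (d - a) * p * r - b * r ^ 2)) := by
  have key : !![p, q; r, s] * !![a, b; c, d] = (!![a, b; c, d])⁻¹ * !![p, q; r, s] ↔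
      s = -p ∧ c * q = (d - a) * p - b * r := by
    rw [inv_fin_two_of_det_eq_one h1, Matrix.mul_fin_two, Matrix.mul_fin_two]
    simp only [EmbeddingLike.apply_eq_iff_eq, Matrix.vecCons_inj, and_true]
    constructor
    · rintro ⟨⟨h₁₁, h₁₂⟩, -⟩
      exact ⟨mul_left_cancel₀ hb (by linear_combination h₁₂), by linear_combination h₁₁⟩
    · rintro ⟨rfl, h⟩
      exact ⟨⟨by linear_combination h, by ring⟩, by ring, by linear_combination h⟩
  refine ⟨key, fun hA => ?_⟩
  obtain ⟨rfl, h⟩ := key.mp hA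
  rw [Matrix.det_fin_two_of]
  linear_combination -r * h
end

section
/- Let a,b,c,d be integers with a·d − b·c = 1, |a+d| > 2 and c ≠ 0, and let φ = [[a,b],[c,d]]. Then S(φ) equals the set of integers of the form p² + ((d−a)·p·r − b·r²)/c where p, r range over integers such that either (c divides b·r and c divides (d−a)·r) or c divides ((d−a)·p − b·r). -/
/-- The set `S(φ)` of Theorem 3.1: all integers `k·ε·det A` with `k` a positive integer,
`ε = ±1`, and `A` a 2×2 integer matrix satisfying `A·φ = (φ^ε)^k·A`. -/
def selfMapDegrees (φ : Matrix (Fin 2) (Fin 2) ℤ) : Set ℤ :=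
  {l | ∃ (k : ℕ) (ε : ℤ) (A : Matrix (Fin 2) (Fin 2) ℤ),
    0 < k ∧ (ε = 1 ∨ ε = -1) ∧ A * φ = (φ ^ ε) ^ k * A ∧ l = (k : ℤ) * ε * A.det}

theorem Matrix.trace_eq_trace_of_mul_eq_mul {R n : Type*} [CommRing R] [IsDomain R] [Fintype n]
    [DecidableEq n] {A M N : Matrix n n R} (hA : A.det ≠ 0) (h : A * M = N * A) :
    M.trace = N.trace := by
  refine mul_left_cancel₀ hA ?_
  have key : (A * M * A.adjugate).trace = (N * A * A.adjugate).trace := by rw [h]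
  rw [Matrix.trace_mul_comm, ← Matrix.mul_assoc, Matrix.adjugate_mul, Matrix.mul_assoc N,
    Matrix.mul_adjugate] at key
  simpa using key

theorem Matrix.trace_pow_add_two_of_det_eq_one_s6 {R : Type*} [CommRing R]
    {M : Matrix (Fin 2) (Fin 2) R} (hM : M.det = 1) (k : ℕ) :
    (M ^ (k + 2)).trace = M.trace * (M ^ (k + 1)).trace - (M ^ k).trace := by
  have hsq : M ^ 2 = M.trace • M - 1 := by
    rw [Matrix.det_fin_two] at hM
    ext i j
    fin_cases i <;> fin_cases j <;>
      simp [pow_two, Matrix.mul_apply, Fin.sum_univ_two, Matrix.trace_fin_two] <;>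
      first | linear_combination -hM | ring
  rw [pow_add, hsq, mul_sub, mul_one, Matrix.mul_smul, ← pow_succ, Matrix.trace_sub,
    Matrix.trace_smul, smul_eq_mul]

theorem Matrix.abs_trace_pow_lt_abs_trace_pow_succ {M : Matrix (Fin 2) (Fin 2) ℤ}
    (hM : M.det = 1) (ht : 2 < |M.trace|) (k : ℕ) :
    |(M ^ k).trace| < |(M ^ (k + 1)).trace| := by
  induction k with
  | zero => simpa using ht
  | succ k ih =>
    rw [Matrix.trace_pow_add_two_of_det_eq_one_s6 hM]
    have h := abs_sub_abs_le_abs_sub (M.trace * (M ^ (k + 1)).trace) (M ^ k).trace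
    rw [abs_mul] at h
    nlinarith [abs_nonneg (M ^ k).trace]

theorem Matrix.eq_one_of_abs_trace_pow_eq {M : Matrix (Fin 2) (Fin 2) ℤ}
    (hM : M.det = 1) (ht : 2 < |M.trace|) {k : ℕ} (h : |(M ^ k).trace| = |M.trace|) : k = 1 := by
  have hmono : StrictMono fun k : ℕ => |(M ^ k).trace| :=
    strictMono_nat_of_lt_succ (Matrix.abs_trace_pow_lt_abs_trace_pow_succ hM ht)
  exact hmono.injective (by simpa using h)

/-- The Sol row of Theorem 1.4: for an Anosov `φ = [[a,b],[c,d]] ∈ SL₂(ℤ)`, the degree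
set is given by the quadratic form `p² + ((d−a)·p·r − b·r²)/c` under the divisibility
conditions. -/
theorem sol_torus_bundle_degrees (a b c d : ℤ)
    (h1 : a * d - b * c = 1) (htr : 2 < |a + d|) (hc : c ≠ 0) :
    selfMapDegrees !![a, b; c, d] =
      {l | ∃ p r : ℤ,
        ((c ∣ b * r ∧ c ∣ (d - a) * r) ∨ c ∣ ((d - a) * p - b * r)) ∧
        l = p ^ 2 + ((d - a) * p * r - b * r ^ 2) / c} := by
  have hdet : (!![a, b; c, d] : Matrix (Fin 2) (Fin 2) ℤ).det = 1 := by
    rw [Matrix.det_fin_two_of, h1]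
  have hinv : (!![a, b; c, d] : Matrix (Fin 2) (Fin 2) ℤ) ^ (-1 : ℤ) = !![d, -b; -c, a] := by
    rw [zpow_neg_one, Matrix.inv_def, hdet, Matrix.adjugate_fin_two_of]
    simp
  ext l
  constructor
  · rintro ⟨k, ε, A, -, hε, hA, rfl⟩
    by_cases h0 : A.det = 0
    · exact ⟨0, 0, by simp, by simp [h0]⟩
    have hk : k = 1 := by
      have htrace := Matrix.trace_eq_trace_of_mul_eq_mul h0 hA
      rcases hε with rfl | rfl
      · rw [zpow_one] at htrace
        exact Matrix.eq_one_of_abs_trace_pow_eq hdet (by simpa [Matrix.trace_fin_two] using htr)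
          (by rw [htrace])
      · rw [hinv] at htrace
        refine Matrix.eq_one_of_abs_trace_pow_eq (M := !![d, -b; -c, a]) ?_ ?_ ?_
        · rw [Matrix.det_fin_two_of]
          linarith
        · simpa [Matrix.trace_fin_two, add_comm] using htr
        · rw [← htrace]
          simp [Matrix.trace_fin_two, add_comm]
    subst hk
    obtain ⟨x, y, z, w, rfl⟩ : ∃ x y z w, A = !![x, y; z, w] :=
      ⟨_, _, _, _, Matrix.eta_fin_two A⟩
    refine ⟨x, z, ?_⟩
    rw [pow_one] at hA
    rcases hε with rfl | rfl
    · simp only [zpow_one, Matrix.mul_fin_two, ← Matrix.ext_iff, Fin.forall_fin_two] at hA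
      simp at hA
      obtain ⟨⟨e1, -⟩, e3, -⟩ := hA
      refine ⟨Or.inl ⟨⟨y, by linarith⟩, ⟨w - x, by linarith⟩⟩, ?_⟩
      rw [show (d - a) * x * z - b * z ^ 2 = c * (x * (w - x) - y * z) by
        linear_combination (-x) * e3 + z * e1, Int.mul_ediv_cancel_left _ hc,
        Matrix.det_fin_two_of]
      push_cast
      ring
    · rw [hinv] at hA
      simp only [Matrix.mul_fin_two, ← Matrix.ext_iff, Fin.forall_fin_two] at hA
      simp at hA
      obtain ⟨⟨e1, -⟩, e3, -⟩ := hA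
      have hw : w = -x := mul_left_cancel₀ hc (by linarith)
      subst hw
      refine ⟨Or.inr ⟨y, by linarith⟩, ?_⟩
      rw [show (d - a) * x * z - b * z ^ 2 = c * (y * z) by
        linear_combination (-z) * e1, Int.mul_ediv_cancel_left _ hc, Matrix.det_fin_two_of]
      push_cast
      ring
  · rintro ⟨p, r, ⟨⟨y, hy⟩, ⟨u, hu⟩⟩ | ⟨y, hy⟩, rfl⟩
    · refine ⟨1, 1, !![p, y; r, p + u], one_pos, Or.inl rfl, ?_, ?_⟩
      · have e : b * u = (d - a) * y :=
          mul_left_cancel₀ hc (by linear_combination (d - a) * hy - b * hu)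
        rw [zpow_one, pow_one, Matrix.mul_fin_two, Matrix.mul_fin_two]
        ext i j
        fin_cases i <;> fin_cases j <;> simp <;> grind
      · rw [show (d - a) * p * r - b * r ^ 2 = c * (p * u - y * r) by
          linear_combination p * hu - r * hy, Int.mul_ediv_cancel_left _ hc,
          Matrix.det_fin_two_of]
        push_cast
        ring
    · refine ⟨1, -1, !![p, y; r, -p], one_pos, Or.inr rfl, ?_, ?_⟩
      · rw [hinv, pow_one, Matrix.mul_fin_two, Matrix.mul_fin_two]
        ext i j
        fin_cases i <;> fin_cases j <;> simp <;> grind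
      · rw [show (d - a) * p * r - b * r ^ 2 = c * (y * r) by
          linear_combination r * hy, Int.mul_ediv_cancel_left _ hc, Matrix.det_fin_two_of]
        push_cast
        ring
end

section
/- For φ = [[-1,-1],[1,0]] (an element of order 3 in SL₂(ℤ)), the set S(φ) equals { (3t+1)·(p² − p·q + q²) : t, p, q ∈ ℤ }. -/
/-- The square of the order-three monodromy. -/
lemma orderThree_sq :
    (!![-1, -1; 1, 0] : Matrix (Fin 2) (Fin 2) ℤ) ^ 2 = !![0, 1; -1, -1] := by
  simp [pow_two]

lemma orderThree_cube : (!![-1, -1; 1, 0] : Matrix (Fin 2) (Fin 2) ℤ) ^ 3 = 1 := by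
  rw [pow_succ, orderThree_sq]
  simp [Matrix.one_fin_two]

lemma orderThree_zpow_neg_one :
    (!![-1, -1; 1, 0] : Matrix (Fin 2) (Fin 2) ℤ) ^ (-1 : ℤ) = !![-1, -1; 1, 0] ^ 2 := by
  rw [Matrix.zpow_neg_one]
  exact Matrix.inv_eq_left_inv (by rw [← pow_succ, orderThree_cube])

/-- A signed power of the order-three monodromy only depends on the exponent modulo `3`. -/
lemma orderThree_zpow_pow {ε : ℤ} (hε : ε = 1 ∨ ε = -1) {k m : ℕ}
    (h : (k : ℤ) * ε ≡ m [ZMOD 3]) :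
    ((!![-1, -1; 1, 0] : Matrix (Fin 2) (Fin 2) ℤ) ^ ε) ^ k = !![-1, -1; 1, 0] ^ m := by
  rcases hε with rfl | rfl
  · rw [zpow_one, pow_eq_pow_mod k orderThree_cube, pow_eq_pow_mod m orderThree_cube]
    congr 1
    unfold Int.ModEq at h
    omega
  · rw [orderThree_zpow_neg_one, ← pow_mul, pow_eq_pow_mod (2 * k) orderThree_cube,
      pow_eq_pow_mod m orderThree_cube]
    congr 1
    unfold Int.ModEq at h
    omega

/-- The E³ row of Theorem 1.4 for monodromy of order 3:
`S([[-1,-1],[1,0]]) = {(3t+1)(p² − pq + q²)}`. -/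
theorem order_three_torus_bundle_degrees :
    selfMapDegrees !![-1, -1; 1, 0] =
      {l | ∃ t p q : ℤ, l = (3 * t + 1) * (p ^ 2 - p * q + q ^ 2)} := by
  ext l
  constructor
  · rintro ⟨k, ε, A, -, hε, hA, rfl⟩
    obtain ⟨a, b, c, d, rfl⟩ : ∃ a b c d, A = !![a, b; c, d] := ⟨_, _, _, _, A.eta_fin_two⟩
    rw [Matrix.det_fin_two_of]
    generalize hn : (k : ℤ) * ε = n
    obtain ⟨t, ht⟩ : ∃ t, n = 3 * t ∨ n = 3 * t + 1 ∨ n = 3 * t + 2 := ⟨n / 3, by omega⟩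
    rcases ht with ht | ht | ht
    · rw [orderThree_zpow_pow (m := 0) hε (by unfold Int.ModEq; omega), pow_zero, one_mul] at hA
      simp at hA
      obtain rfl : a = 0 := by omega
      obtain rfl : c = 0 := by omega
      obtain rfl : b = 0 := by omega
      exact ⟨0, 0, 0, by simp⟩
    · rw [orderThree_zpow_pow (m := 1) hε (by unfold Int.ModEq; omega), pow_one] at hA
      simp at hA
      obtain rfl : b = -c := by omega
      obtain rfl : d = a + c := by omega
      exact ⟨t, a, -c, by rw [ht]; ring⟩
    · rw [orderThree_zpow_pow (m := 2) hε (by unfold Int.ModEq; omega), orderThree_sq] at hA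
      simp at hA
      obtain rfl : c = b - a := by omega
      obtain rfl : d = -a := by omega
      exact ⟨-t - 1, a, b, by rw [ht]; ring⟩
  · rintro ⟨t, p, q, rfl⟩
    obtain ⟨k, ε, hk, hε, hkε⟩ :
        ∃ (k : ℕ) (ε : ℤ), 0 < k ∧ (ε = 1 ∨ ε = -1) ∧ (k : ℤ) * ε = 3 * t + 1 := by
      rcases le_or_gt 0 t with ht | ht
      · exact ⟨(3 * t + 1).toNat, 1, by omega, .inl rfl, by omega⟩
      · exact ⟨(-(3 * t + 1)).toNat, -1, by omega, .inr rfl, by omega⟩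
    refine ⟨k, ε, !![p, q; -q, p - q], hk, hε, ?_, ?_⟩
    · rw [orderThree_zpow_pow (m := 1) hε (by unfold Int.ModEq; omega), pow_one]
      simp
      ring
    · rw [Matrix.det_fin_two_of, hkε]
      ring
end

section
/- For φ = [[0,-1],[1,0]] (an element of order 4 in SL₂(ℤ)), the set S(φ) equals { (4t+1)·(p² + q²) : t, p, q ∈ ℤ }. -/
/-- The inverse of the rotation of order four, as an integer matrix power. -/
theorem rotation_zpow_neg_one :
    (!![0, -1; 1, 0] : Matrix (Fin 2) (Fin 2) ℤ) ^ (-1 : ℤ) = !![0, 1; -1, 0] := by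
  rw [Matrix.zpow_neg_one]
  apply Matrix.inv_eq_right_inv
  ext i j
  fin_cases i <;> fin_cases j <;> simp

theorem rotation_pow_four :
    (!![0, -1; 1, 0] : Matrix (Fin 2) (Fin 2) ℤ) ^ 4 = 1 := by
  decide

theorem rotation_inv_pow_four :
    (!![0, 1; -1, 0] : Matrix (Fin 2) (Fin 2) ℤ) ^ 4 = 1 := by
  decide

theorem pow_four_mul_add {M : Type*} [Monoid M] {x : M} (hx : x ^ 4 = 1) (s r : ℕ) :
    x ^ (4 * s + r) = x ^ r := by
  rw [pow_add, pow_mul, hx, one_pow, one_mul]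

/-- The condition `A * φ = B * A` for the rotation `φ` of order four, entry by entry. -/
theorem mul_rotation_eq_mul_iff (a b c d x y z w : ℤ) :
    !![a, b; c, d] * !![0, -1; 1, 0] = !![x, y; z, w] * !![a, b; c, d] ↔
      (b = x * a + y * c ∧ -a = x * b + y * d) ∧ d = z * a + w * c ∧ -c = z * b + w * d := by
  simp

/-- Powers of the rotation of order four and of its inverse, up to the exponent mod four. -/
theorem rotation_zpow_pow (ε : ℤ) (hε : ε = 1 ∨ ε = -1) (k : ℕ) :
    ∃ t : ℤ,
      (k * ε = 4 * t ∧ ((!![0, -1; 1, 0] : Matrix (Fin 2) (Fin 2) ℤ) ^ ε) ^ k = !![1, 0; 0, 1]) ∨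
      (k * ε = 4 * t + 1 ∧
        ((!![0, -1; 1, 0] : Matrix (Fin 2) (Fin 2) ℤ) ^ ε) ^ k = !![0, -1; 1, 0]) ∨
      (k * ε = 4 * t + 2 ∧
        ((!![0, -1; 1, 0] : Matrix (Fin 2) (Fin 2) ℤ) ^ ε) ^ k = !![-1, 0; 0, -1]) ∨
      (k * ε = 4 * t + 3 ∧
        ((!![0, -1; 1, 0] : Matrix (Fin 2) (Fin 2) ℤ) ^ ε) ^ k = !![0, 1; -1, 0]) := by
  obtain ⟨s, r, hr, rfl⟩ : ∃ s r : ℕ, r < 4 ∧ k = 4 * s + r :=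
    ⟨k / 4, k % 4, Nat.mod_lt _ (by norm_num), (Nat.div_add_mod k 4).symm⟩
  rcases hε with rfl | rfl
  · rw [zpow_one, pow_four_mul_add rotation_pow_four]
    refine ⟨s, ?_⟩
    interval_cases r
    · exact Or.inl ⟨by push_cast; ring, by decide⟩
    · exact Or.inr (Or.inl ⟨by push_cast; ring, by decide⟩)
    · exact Or.inr (Or.inr (Or.inl ⟨by push_cast; ring, by decide⟩))
    · exact Or.inr (Or.inr (Or.inr ⟨by push_cast; ring, by decide⟩))
  · rw [rotation_zpow_neg_one, pow_four_mul_add rotation_inv_pow_four]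
    interval_cases r
    · exact ⟨-s, Or.inl ⟨by push_cast; ring, by decide⟩⟩
    · exact ⟨-s - 1, Or.inr (Or.inr (Or.inr ⟨by push_cast; ring, by decide⟩))⟩
    · exact ⟨-s - 1, Or.inr (Or.inr (Or.inl ⟨by push_cast; ring, by decide⟩))⟩
    · exact ⟨-s - 1, Or.inr (Or.inl ⟨by push_cast; ring, by decide⟩)⟩

/-- The E³ row of Theorem 1.4 for monodromy of order 4:
`S([[0,-1],[1,0]]) = {(4t+1)(p² + q²)}`. -/
theorem order_four_torus_bundle_degrees :
    selfMapDegrees !![0, -1; 1, 0] =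
      {l | ∃ t p q : ℤ, l = (4 * t + 1) * (p ^ 2 + q ^ 2)} := by
  ext l
  constructor
  · rintro ⟨k, ε, A, -, hε, hA, rfl⟩
    obtain ⟨a, b, c, d, rfl⟩ : ∃ a b c d, A = !![a, b; c, d] := ⟨_, _, _, _, A.eta_fin_two⟩
    obtain ⟨t, ⟨hk, hM⟩ | ⟨hk, hM⟩ | ⟨hk, hM⟩ | ⟨hk, hM⟩⟩ := rotation_zpow_pow ε hε k <;>
      rw [hM, mul_rotation_eq_mul_iff] at hA <;>
      rw [hk, Matrix.det_fin_two_of] <;>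
      obtain ⟨⟨h₁, h₂⟩, h₃, h₄⟩ := hA
    · obtain rfl : a = 0 := by omega
      obtain rfl : b = 0 := by omega
      exact ⟨0, 0, 0, by ring⟩
    · obtain rfl : b = -c := by omega
      obtain rfl : d = a := by omega
      exact ⟨t, d, c, by ring⟩
    · obtain rfl : a = 0 := by omega
      obtain rfl : b = 0 := by omega
      exact ⟨0, 0, 0, by ring⟩
    · obtain rfl : b = c := by omega
      obtain rfl : d = -a := by omega
      exact ⟨-t - 1, a, b, by ring⟩
  · rintro ⟨t, p, q, rfl⟩
    obtain ⟨k, ε, hk, hε, hkε⟩ :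
        ∃ (k : ℕ) (ε : ℤ), 0 < k ∧ (ε = 1 ∨ ε = -1) ∧ (k : ℤ) * ε = 4 * t + 1 := by
      rcases le_or_gt 0 t with ht | ht
      · exact ⟨(4 * t + 1).toNat, 1, by omega, Or.inl rfl, by omega⟩
      · exact ⟨(-(4 * t + 1)).toNat, -1, by omega, Or.inr rfl, by omega⟩
    refine ⟨k, ε, !![p, -q; q, p], hk, hε, ?_, ?_⟩
    · obtain ⟨s, ⟨hs, hM⟩ | ⟨hs, hM⟩ | ⟨hs, hM⟩ | ⟨hs, hM⟩⟩ := rotation_zpow_pow ε hε k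
      · omega
      · rw [hM, mul_rotation_eq_mul_iff]
        omega
      · omega
      · omega
    · rw [hkε, Matrix.det_fin_two_of]
      ring
end

section
/- For φ = [[0,-1],[1,1]] (an element of order 6 in SL₂(ℤ)), the set S(φ) equals { (6t+1)·(p² − p·q + q²) : t, p, q ∈ ℤ }. -/
theorem Matrix.zpow_neg_one_orderSix :
    (!![0, -1; 1, 1] : Matrix (Fin 2) (Fin 2) ℤ) ^ (-1 : ℤ) = !![1, 1; -1, 0] := by
  rw [Matrix.zpow_neg_one]
  exact Matrix.inv_eq_right_inv (by decide)

theorem Matrix.orderSix_pow_mod (k : ℕ) :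
    (!![0, -1; 1, 1] : Matrix (Fin 2) (Fin 2) ℤ) ^ k = !![0, -1; 1, 1] ^ (k % 6) :=
  pow_eq_pow_mod k (by decide)

theorem Matrix.orderSix_inv_pow_mod (k : ℕ) :
    (!![1, 1; -1, 0] : Matrix (Fin 2) (Fin 2) ℤ) ^ k = !![1, 1; -1, 0] ^ (k % 6) :=
  pow_eq_pow_mod k (by decide)

/-- The solutions `A` of `A * φ = φ ^ r * A` for `φ` of order six: either `A` vanishes, or
`r` is `1` or `5` and `A` is determined by its first row. -/
theorem Matrix.orderSix_intertwiner {r : ℕ} (hr : r < 6) {a b c d : ℤ}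
    (h : !![a, b; c, d] * !![0, -1; 1, 1] = !![0, -1; 1, 1] ^ r * !![a, b; c, d]) :
    (a = 0 ∧ b = 0 ∧ c = 0 ∧ d = 0) ∨ (r = 1 ∧ c = -b ∧ d = a - b) ∨
      (r = 5 ∧ c = b - a ∧ d = -a) := by
  interval_cases r <;>
    simp [pow_succ] at h <;> omega

theorem Matrix.orderSix_inv_intertwiner {r : ℕ} (hr : r < 6) {a b c d : ℤ}
    (h : !![a, b; c, d] * !![0, -1; 1, 1] = !![1, 1; -1, 0] ^ r * !![a, b; c, d]) :
    (a = 0 ∧ b = 0 ∧ c = 0 ∧ d = 0) ∨ (r = 5 ∧ c = -b ∧ d = a - b) ∨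
      (r = 1 ∧ c = b - a ∧ d = -a) := by
  interval_cases r <;>
    simp [pow_succ] at h <;> omega

/-- The E³ row of Theorem 1.4 for monodromy of order 6:
`S([[0,-1],[1,1]]) = {(6t+1)(p² − pq + q²)}`. -/
theorem order_six_torus_bundle_degrees :
    selfMapDegrees !![0, -1; 1, 1] =
      {l | ∃ t p q : ℤ, l = (6 * t + 1) * (p ^ 2 - p * q + q ^ 2)} := by
  ext l
  constructor
  · rintro ⟨k, ε, A, -, hε, hA, rfl⟩
    rw [Matrix.eta_fin_two A] at hA ⊢
    generalize A 0 0 = a, A 0 1 = b, A 1 0 = c, A 1 1 = d at hA ⊢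
    rw [Matrix.det_fin_two_of]
    have hk : k % 6 < 6 := Nat.mod_lt _ (by norm_num)
    rcases hε with rfl | rfl
    · rw [zpow_one, Matrix.orderSix_pow_mod] at hA
      rcases Matrix.orderSix_intertwiner hk hA with
        ⟨rfl, rfl, rfl, rfl⟩ | ⟨hr, rfl, rfl⟩ | ⟨hr, rfl, rfl⟩
      · exact ⟨0, 0, 0, by ring⟩
      · obtain ⟨t, ht⟩ : ∃ t : ℤ, (k : ℤ) = 6 * t + 1 := ⟨k / 6, by omega⟩
        exact ⟨t, a, b, by rw [ht]; ring⟩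
      · obtain ⟨t, ht⟩ : ∃ t : ℤ, (k : ℤ) = -(6 * t + 1) := ⟨-(k / 6) - 1, by omega⟩
        exact ⟨t, a, b, by rw [ht]; ring⟩
    · rw [Matrix.zpow_neg_one_orderSix, Matrix.orderSix_inv_pow_mod] at hA
      rcases Matrix.orderSix_inv_intertwiner hk hA with
        ⟨rfl, rfl, rfl, rfl⟩ | ⟨hr, rfl, rfl⟩ | ⟨hr, rfl, rfl⟩
      · exact ⟨0, 0, 0, by ring⟩
      · obtain ⟨t, ht⟩ : ∃ t : ℤ, (k : ℤ) = -(6 * t + 1) := ⟨-(k / 6) - 1, by omega⟩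
        exact ⟨t, a, b, by rw [ht]; ring⟩
      · obtain ⟨t, ht⟩ : ∃ t : ℤ, (k : ℤ) = 6 * t + 1 := ⟨k / 6, by omega⟩
        exact ⟨t, a, b, by rw [ht]; ring⟩
  · rintro ⟨t, p, q, rfl⟩
    have hdet : (!![p, q; -q, p - q] : Matrix (Fin 2) (Fin 2) ℤ).det = p ^ 2 - p * q + q ^ 2 := by
      rw [Matrix.det_fin_two_of]; ring
    have hcomm : !![p, q; -q, p - q] * !![0, -1; 1, 1] =
        !![0, -1; 1, 1] * !![p, q; -q, p - q] := by
      simp; omega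
    rcases le_or_gt 0 t with ht | ht
    · refine ⟨(6 * t + 1).toNat, 1, !![p, q; -q, p - q], by omega, Or.inl rfl, ?_, ?_⟩
      · rw [zpow_one, Matrix.orderSix_pow_mod, show (6 * t + 1).toNat % 6 = 1 by omega, pow_one,
          hcomm]
      · rw [hdet, Int.toNat_of_nonneg (by omega)]; ring
    · refine ⟨(-(6 * t + 1)).toNat, -1, !![p, q; -q, p - q], by omega, Or.inr rfl, ?_, ?_⟩
      · rw [Matrix.zpow_neg_one_orderSix, Matrix.orderSix_inv_pow_mod,
          show (-(6 * t + 1)).toNat % 6 = 5 by omega, hcomm]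
        congr 1
        decide
      · rw [hdet, Int.toNat_of_nonneg (by omega)]; ring
end

section
/- Let a,b,c,d be integers with a·d − b·c = 1, b ≠ 0 and |a+d| > 2. If there exist integers p, r with b·p² + (d−a)·p·r − c·r² = −b, then for every prime q with q ≡ 3 (mod 4), the q-adic valuation of (a+d)² − 4 is even. -/
/-- A prime congruent to `3` modulo `4` occurs to an even power in a sum of two integer squares. -/
theorem even_padicValInt_sq_add_sq {q : ℕ} (hq : q.Prime) (hq4 : q % 4 = 3) (x y : ℤ) :
    Even (padicValInt q (x ^ 2 + y ^ 2)) := by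
  have hn : (x ^ 2 + y ^ 2).natAbs = x.natAbs ^ 2 + y.natAbs ^ 2 := by
    rw [Int.natAbs_add_of_nonneg (sq_nonneg x) (sq_nonneg y), Int.natAbs_pow, Int.natAbs_pow]
  rw [padicValInt, hn]
  by_cases hmem : q ∈ (x.natAbs ^ 2 + y.natAbs ^ 2).primeFactors
  · exact Nat.eq_sq_add_sq_iff.mp ⟨_, _, rfl⟩ q hmem hq4
  · rw [← Nat.factorization_def _ hq, Finsupp.notMem_support_iff.mp hmem]
    exact Even.zero

/-- A prime congruent to `3` modulo `4` occurs to an even power in every nonzero integer having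
a nonzero square multiple that is a sum of two squares. -/
theorem even_padicValInt_of_mul_sq_eq_sq_add_sq {q : ℕ} (hq : q.Prime) (hq4 : q % 4 = 3)
    {n r x y : ℤ} (hn : n ≠ 0) (hr : r ≠ 0) (h : n * r ^ 2 = x ^ 2 + y ^ 2) :
    Even (padicValInt q n) := by
  have : Fact q.Prime := ⟨hq⟩
  have hval := even_padicValInt_sq_add_sq hq hq4 x y
  rw [← h, sq r, padicValInt.mul hn (mul_ne_zero hr hr), padicValInt.mul hr hr] at hval
  exact (Nat.even_add.mp hval).mpr ⟨_, rfl⟩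

/-- Conclusion of Example 1.8: if `−1` is a self-mapping degree of the Sol torus bundle
with monodromy `[[a,b],[c,d]]` (i.e. `b·p² + (d−a)·p·r − c·r² = −b` has an integer
solution), then every prime `q ≡ 3 (mod 4)` occurs to an even power in `(a+d)² − 4`. -/
theorem no_odd_power_three_mod_four_prime (a b c d : ℤ)
    (h1 : a * d - b * c = 1) (hb : b ≠ 0) (htr : 2 < |a + d|)
    (h2 : ∃ p r : ℤ, b * p ^ 2 + (d - a) * p * r - c * r ^ 2 = -b) :
    ∀ q : ℕ, q.Prime → q % 4 = 3 → Even (padicValInt q ((a + d) ^ 2 - 4)) := by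
  intro q hq hq4
  obtain ⟨p, r, hpr⟩ := h2
  have hid : ((a + d) ^ 2 - 4) * r ^ 2 = (2 * b * p + (d - a) * r) ^ 2 + (2 * b) ^ 2 := by
    linear_combination -4 * b * hpr + 4 * r ^ 2 * h1
  have hr : r ≠ 0 := by
    rintro rfl
    have : 0 < b ^ 2 := by positivity
    nlinarith [sq_nonneg (2 * b * p)]
  have hn : (a + d) ^ 2 - 4 ≠ 0 := by
    nlinarith [sq_abs (a + d)]
  exact even_padicValInt_of_mul_sq_eq_sq_add_sq hq hq4 hn hr hid
end

section
/- Let a,b,c,d be integers with a·d − b·c = 1, let φ = [[a,b],[c,d]] and τ = [[1,0],[0,-1]]. Then τ·φ·τ·φ⁻¹ = [[a·d + b·c, −2·a·b],[−2·c·d, a·d + b·c]]. Moreover, if a, b, c, d are all nonzero, then |a·d + b·c| = |2·b·c + 1| ≥ 3, so the trace of τ·φ·τ·φ⁻¹ has absolute value greater than 2. -/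
theorem conj_reflection_mul_inv_eq (a b c d : ℤ) (h : a * d - b * c = 1) :
    (!![1, 0; 0, -1] * !![a, b; c, d] * !![1, 0; 0, -1] * (!![a, b; c, d])⁻¹ :
        Matrix (Fin 2) (Fin 2) ℤ)
      = !![a * d + b * c, -2 * (a * b); -2 * (c * d), a * d + b * c] := by
  rw [Matrix.inv_def, Matrix.det_fin_two_of, h, Ring.inverse_one, one_smul,
    Matrix.adjugate_fin_two_of]
  ext i j
  fin_cases i <;> fin_cases j <;> simp [Matrix.mul_apply, Fin.sum_univ_two] <;> ring

theorem three_le_abs_mul_add_mul {a b c d : ℤ} (h : a * d - b * c = 1)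
    (ha : a ≠ 0) (hb : b ≠ 0) (hc : c ≠ 0) (hd : d ≠ 0) : 3 ≤ |a * d + b * c| := by
  have had : a * d ≠ 0 := mul_ne_zero ha hd
  have hbc : b * c ≠ 0 := mul_ne_zero hb hc
  rw [le_abs]
  omega

/-- Lemma 2.9 / Section 2.4: for `φ = [[a,b],[c,d]] ∈ SL₂(ℤ)` and `τ = [[1,0],[0,-1]]`,
`τφτφ⁻¹ = [[ad+bc, −2ab],[−2cd, ad+bc]]`; if moreover `abcd ≠ 0` then
`|ad+bc| = |2bc+1| ≥ 3`, so the trace of `τφτφ⁻¹` has absolute value `> 2`. -/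
theorem double_cover_monodromy_anosov (a b c d : ℤ) (h1 : a * d - b * c = 1) :
    (!![1, 0; 0, -1] * !![a, b; c, d] * !![1, 0; 0, -1] * (!![a, b; c, d])⁻¹
        = !![a * d + b * c, -2 * (a * b); -2 * (c * d), a * d + b * c]) ∧
    (a ≠ 0 → b ≠ 0 → c ≠ 0 → d ≠ 0 →
      |a * d + b * c| = |2 * (b * c) + 1| ∧ 3 ≤ |a * d + b * c| ∧
      2 < |(!![1, 0; 0, -1] * !![a, b; c, d] * !![1, 0; 0, -1]
              * (!![a, b; c, d])⁻¹ : Matrix (Fin 2) (Fin 2) ℤ).trace|) := by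
  refine ⟨conj_reflection_mul_inv_eq a b c d h1, fun ha hb hc hd => ?_⟩
  have h3 := three_le_abs_mul_add_mul h1 ha hb hc hd
  refine ⟨congrArg abs (by linarith), h3, ?_⟩
  rw [conj_reflection_mul_inv_eq a b c d h1, Matrix.trace_fin_two_of, ← two_mul, abs_mul, abs_two]
  linarith
end

section
/- Let K be the group whose underlying set is ℤ × ℤ with multiplication (m,n)·(p,q) = (m+p, (−1)^p·n + q) (the Klein bottle group, with a = (1,0), b = (0,1) satisfying a = b·a·b). If elements g = (m', q) and h = (p, n) of K satisfy g = h·g·h, then p = 0, and moreover m' is odd or n = 0. -/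
/-- Multiplication of the Klein bottle group `⟨a, b | a = bab⟩` on `ℤ × ℤ`, where `(m,n)`
corresponds to `a^m·b^n`: `(m,n)·(p,q) = (m+p, (−1)^p·n + q)`. -/
def kleinMul (x y : ℤ × ℤ) : ℤ × ℤ :=
  (x.1 + y.1, (((-1 : ℤˣ) ^ y.1 : ℤˣ) : ℤ) * x.2 + y.2)

/-- The algebraic core of Lemma 4.1: if elements `g = (m', q)` and `h = (p, n)` of the
Klein bottle group satisfy `g = h·g·h`, then `p = 0`, and `m'` is odd or `n = 0`. -/
theorem klein_group_relation (m' q p n : ℤ)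
    (h : kleinMul (kleinMul (p, n) (m', q)) (p, n) = (m', q)) :
    p = 0 ∧ (Odd m' ∨ n = 0) := by
  simp only [kleinMul, Prod.mk.injEq] at h
  obtain ⟨h₁, h₂⟩ := h
  obtain rfl : p = 0 := by omega
  refine ⟨rfl, (Int.even_or_odd m').symm.imp_right fun hm => ?_⟩
  simp only [hm.neg_one_zpow, zpow_zero, Units.val_one, one_mul] at h₂
  omega
end

section
/- Let z be an integer, φ = [[0,1],[1,z]] and τ = [[1,0],[0,-1]]. Then for every integer s ≥ 0, (φ·τ·φ⁻¹·τ)^s · φ = (−1)^s · [[0,1],[1,(2s+1)·z]]. -/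
theorem semi_bundle_inv (z : ℤ) : (!![0, 1; 1, z])⁻¹ = !![-z, 1; 1, 0] := by
  apply Matrix.inv_eq_right_inv
  ext i j
  fin_cases i <;> fin_cases j <;> simp [Matrix.mul_apply, Fin.sum_univ_two]

theorem semi_bundle_commutator (z : ℤ) :
    !![0, 1; 1, z] * !![1, 0; 0, -1] * (!![0, 1; 1, z])⁻¹ * !![1, 0; 0, -1]
      = !![-1, 0; -2 * z, -1] := by
  rw [semi_bundle_inv]
  ext i j
  fin_cases i <;> fin_cases j <;> simp [Matrix.mul_apply, Fin.sum_univ_two]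
  ring

/-- Case (C) of Section 4 (case 2.II): for `φ = [[0,1],[1,z]]` and `τ = [[1,0],[0,-1]]`,
`(φτφ⁻¹τ)^s · φ = (−1)^s · [[0,1],[1,(2s+1)z]]` for all `s ≥ 0`. -/
theorem semi_bundle_word_odd_case (z : ℤ) (s : ℕ) :
    (!![0, 1; 1, z] * !![1, 0; 0, -1] * (!![0, 1; 1, z])⁻¹ * !![1, 0; 0, -1]) ^ s
        * !![0, 1; 1, z]
      = ((-1 : ℤ) ^ s) • !![0, 1; 1, (2 * (s : ℤ) + 1) * z] := by
  rw [semi_bundle_commutator]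
  induction s with
  | zero => simp
  | succ s ih =>
    rw [pow_succ', mul_assoc, ih, pow_succ]
    ext i j
    fin_cases i <;> fin_cases j <;> simp [Matrix.mul_apply, Fin.sum_univ_two]
    all_goals ring
end

section
/- Let z be a nonzero integer, s ≥ 0 an integer, k = 2s+1, and let m, n, m', n' be integers such that [[2m'+1,0],[0,n']] · [[0,1],[1,z]] = (−1)^s · [[0,1],[1,k·z]] · [[2m+1,0],[0,n]]. Then n = (−1)^s·(2m'+1), n' = (−1)^s·(2m+1), and 2m+1 = k·n. Consequently k·(2m+1)·n = (k·n)² is the square of an odd integer. -/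
/-- Solution of the matrix equation in case (C) of Section 4 (case 2.II): for `z ≠ 0`,
`k = 2s+1` odd, and diagonal matrices with odd upper-left entries satisfying
`A₂·φ = (−1)^s·[[0,1],[1,kz]]·A₁`, one gets `n = (−1)^s(2m'+1)`, `n' = (−1)^s(2m+1)`,
`2m+1 = k·n`, and the degree `k·(2m+1)·n = (kn)²` is the square of an odd integer. -/
theorem semi_bundle_odd_case_solution (z : ℤ) (hz : z ≠ 0) (s : ℕ) (k : ℤ)
    (hk : k = 2 * (s : ℤ) + 1) (m n m' n' : ℤ)
    (heq : !![2 * m' + 1, 0; 0, n'] * !![0, 1; 1, z]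
      = ((-1 : ℤ) ^ s) • (!![0, 1; 1, k * z] * !![2 * m + 1, 0; 0, n])) :
    n = (-1) ^ s * (2 * m' + 1) ∧ n' = (-1) ^ s * (2 * m + 1) ∧ 2 * m + 1 = k * n ∧
    (k * (2 * m + 1) * n = (k * n) ^ 2 ∧ Odd (k * n)) := by
  have h01 := congrFun (congrFun heq 0) 1
  have h10 := congrFun (congrFun heq 1) 0
  have h11 := congrFun (congrFun heq 1) 1
  simp only [Matrix.mul_apply, Fin.sum_univ_two, Matrix.smul_apply, smul_eq_mul, Matrix.of_apply,
    Matrix.cons_val', Matrix.cons_val_zero, Matrix.cons_val_one, Matrix.cons_val_fin_one,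
    mul_zero, zero_mul, mul_one, one_mul, add_zero, zero_add] at h01 h10 h11
  have hsign : ((-1 : ℤ) ^ s) * (-1) ^ s = 1 := by
    rw [← mul_pow]
    norm_num
  have hkn : 2 * m + 1 = k * n := by
    apply mul_right_cancel₀ hz
    linear_combination (-1) ^ s * h11 - (-1) ^ s * z * h10 - ((2 * m + 1) * z - k * z * n) * hsign
  refine ⟨?_, h10, hkn, ?_, m, hkn.symm⟩
  · linear_combination (-1) ^ s * (-h01) - n * hsign
  · linear_combination k * n * hkn
end

section
/- Let a and d be nonzero integers, g = gcd(a,d) and δ = a·d / g². (i) If x and y are odd integers with y·a = x·d, then δ is odd and x·y = t²·δ for some odd integer t. (ii) Conversely, if δ is odd, then for every odd integer t there exist odd integers x, y with y·a = x·d and x·y = t²·δ. -/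
/-- The arithmetic of Case 1 (`ε = −1`) in Section 4, with `δ = a·d / gcd(a,d)²`:
(i) odd solutions of `y·a = x·d` force `δ` odd and `x·y = t²·δ` with `t` odd;
(ii) conversely if `δ` is odd then every odd `t` is so realized. -/
theorem sol_semi_bundle_arithmetic (a d : ℤ) (ha : a ≠ 0) (hd : d ≠ 0) :
    (∀ x y : ℤ, Odd x → Odd y → y * a = x * d →
      Odd (a * d / (Int.gcd a d : ℤ) ^ 2) ∧
      ∃ t : ℤ, Odd t ∧ x * y = t ^ 2 * (a * d / (Int.gcd a d : ℤ) ^ 2)) ∧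
    (Odd (a * d / (Int.gcd a d : ℤ) ^ 2) →
      ∀ t : ℤ, Odd t → ∃ x y : ℤ, Odd x ∧ Odd y ∧ y * a = x * d ∧
        x * y = t ^ 2 * (a * d / (Int.gcd a d : ℤ) ^ 2)) := by
  have hg : (Int.gcd a d : ℤ) ≠ 0 := by
    exact_mod_cast fun h => ha (Int.gcd_eq_zero_iff.1 h).1
  obtain ⟨p, hp⟩ := Int.gcd_dvd_left a d
  obtain ⟨q, hq⟩ := Int.gcd_dvd_right a d
  have hcop : IsCoprime p q := by
    refine ⟨Int.gcdA a d, Int.gcdB a d, mul_left_cancel₀ hg ?_⟩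
    linear_combination -Int.gcdA a d * hp - Int.gcdB a d * hq - Int.gcd_eq_gcd_ab a d
  generalize (Int.gcd a d : ℤ) = g at *
  have hδ : a * d / g ^ 2 = p * q :=
    Int.ediv_eq_of_eq_mul_right (pow_ne_zero 2 hg) (by rw [hp, hq]; ring)
  have hp0 : p ≠ 0 := by
    rintro rfl
    exact ha (by simpa using hp)
  rw [hδ]
  constructor
  · intro x y hx hy h
    have hxy : y * p = x * q :=
      mul_left_cancel₀ hg (by linear_combination h - y * hp + x * hq)
    obtain ⟨t, rfl⟩ : p ∣ x := hcop.dvd_of_dvd_mul_right ⟨y, by linear_combination -hxy⟩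
    obtain rfl : y = q * t := mul_left_cancel₀ hp0 (by linear_combination hxy)
    rw [Int.odd_mul] at hx hy
    exact ⟨hx.1.mul hy.1, t, hx.2, by ring⟩
  · intro hpq t ht
    rw [Int.odd_mul] at hpq
    exact ⟨p * t, q * t, hpq.1.mul ht, hpq.2.mul ht,
      by rw [hp, hq]; ring, by ring⟩
end
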